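/- arXiv:2311.00352 — 2 statements merged into one kernel-verified Lean document; each statement's English description precedes it below -/
import Mathlib

section
/- Let G be a finite group such that the quotient G/Φ(G) is isomorphic to a non-trivial semidirect product ℤ_p ⋊ ℤ_q, where p and q are distinct primes. Then G is isomorphic to a semidirect product ℤ_{p^m} ⋊ ℤ_{q^n} for some natural numbers m and n; more precisely, G has a normal cyclic Sylow p-subgroup of order p^m and a cyclic Sylow q-subgroup of order q^n, and G is their (internal) semidirect product. -/
/-- A group is *minimal non-nilpotent* if it is not nilpotent but every proper
subgroup of it is nilpotent. -/
def MinimalNonNilpotent (G : Type*) [Group G] : Prop :=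
  ¬ Group.IsNilpotent G ∧ ∀ H : Subgroup G, H ≠ ⊤ → Group.IsNilpotent H

/-- A group is *biminimal non-nilpotent* if it is neither nilpotent nor minimal
non-nilpotent, but every proper subgroup of it is nilpotent or minimal non-nilpotent. -/
def BiminimalNonNilpotent (G : Type*) [Group G] : Prop :=
  ¬ Group.IsNilpotent G ∧ ¬ MinimalNonNilpotent G ∧
    ∀ H : Subgroup G, H ≠ ⊤ → (Group.IsNilpotent H ∨ MinimalNonNilpotent H)

/-- A group is *para-Nil-Hamiltonian* if it is not nilpotent and every non-normal
subgroup of it is either nilpotent or minimal non-nilpotent. -/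
def ParaNilHamiltonian (G : Type*) [Group G] : Prop :=
  ¬ Group.IsNilpotent G ∧
    ∀ H : Subgroup G, ¬ H.Normal → (Group.IsNilpotent H ∨ MinimalNonNilpotent H)

/-- A group is *meta-Nil-Hamiltonian* if every non-nilpotent subgroup of it is normal. -/
def MetaNilHamiltonian (G : Type*) [Group G] : Prop :=
  ∀ H : Subgroup G, ¬ Group.IsNilpotent H → H.Normal

/-- A group is *locally graded* if every non-trivial finitely generated subgroup of it
contains a proper subgroup of finite index. -/
def LocallyGraded (G : Type*) [Group G] : Prop :=
  ∀ H : Subgroup G, H ≠ ⊥ → Group.FG H → ∃ K : Subgroup H, K ≠ ⊤ ∧ K.FiniteIndex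

/-- A group is abelian if its multiplication commutes. -/
def Abelian (G : Type*) [Group G] : Prop := ∀ a b : G, a * b = b * a

/-- A group is *minimal non-abelian* if it is not abelian but every proper
subgroup of it is abelian. -/
def MinimalNonAbelian (G : Type*) [Group G] : Prop :=
  ¬ Abelian G ∧ ∀ H : Subgroup G, H ≠ ⊤ → Abelian H

/-- A group is *biminimal non-abelian* if it is neither abelian nor minimal non-abelian,
but every proper subgroup of it is abelian or minimal non-abelian. -/
def BiminimalNonAbelian (G : Type*) [Group G] : Prop :=
  ¬ Abelian G ∧ ¬ MinimalNonAbelian G ∧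
    ∀ H : Subgroup G, H ≠ ⊤ → (Abelian H ∨ MinimalNonAbelian H)

/-- A group is *parahamiltonian* if it is not abelian and every non-normal subgroup
of it is either abelian or minimal non-abelian. -/
def Parahamiltonian (G : Type*) [Group G] : Prop :=
  ¬ Abelian G ∧ ∀ H : Subgroup G, ¬ H.Normal → (Abelian H ∨ MinimalNonAbelian H)

/-- A group is *locally nilpotent* if every finitely generated subgroup of it is nilpotent. -/
def LocallyNilpotent (G : Type*) [Group G] : Prop :=
  ∀ H : Subgroup G, Group.FG H → Group.IsNilpotent H

open Polynomial in
lemma Module.End.isSemisimple_of_iterate_eq_self {K M : Type*} [Field K] [AddCommGroup M]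
    [Module K M] {N : ℕ} (hN : (N : K) ≠ 0) {f : Module.End K M} (hf : ∀ v, f^[N] v = v) :
    f.IsSemisimple := by
  have hfN : f ^ N = 1 := LinearMap.ext fun v => by rw [Module.End.pow_apply, hf, one_apply]
  exact isSemisimple_of_squarefree_aeval_eq_zero (p := (X ^ N - 1 : K[X]))
    (X_pow_sub_one_separable_iff.2 hN).squarefree (by simp [hfN])

lemma AddSubgroup.exists_isCompl_of_iterate_eq_self {V : Type*} [AddCommGroup V] {p N : ℕ}
    [Fact p.Prime] [Module (ZMod p) V] (hN : ¬ p ∣ N) (T : V →+ V) (hT : ∀ v, T^[N] v = v)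
    (W : AddSubgroup V) (hW : W ≤ W.comap T) :
    ∃ U : AddSubgroup V, U ≤ U.comap T ∧ IsCompl W U := by
  have hf : Module.End.IsSemisimple (T.toZModLinearMap p) :=
    Module.End.isSemisimple_of_iterate_eq_self (N := N)
      (by rwa [Ne, ZMod.natCast_eq_zero_iff]) hT
  let e : AddSubgroup V ≃o Submodule (ZMod p) V := AddSubgroup.toZModSubmodule p
  obtain ⟨U, hU, hWU⟩ := Module.End.isSemisimple_iff.1 hf (e W) hW
  refine ⟨e.symm U, hU, ?_⟩
  rwa [e.isCompl_iff, e.apply_symm_apply]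

lemma Subgroup.exists_isCompl_of_iterate_eq_self {V : Type*} [CommGroup V] {p N : ℕ}
    [Fact p.Prime] (hV : ∀ v : V, v ^ p = 1) (hN : ¬ p ∣ N) (T : V →* V) (hT : ∀ v, T^[N] v = v)
    (W : Subgroup V) (hW : W ≤ W.comap T) : ∃ U : Subgroup V, U ≤ U.comap T ∧ IsCompl W U := by
  let _ : Module (ZMod p) (Additive V) :=
    AddCommGroup.zmodModule fun v => congrArg Additive.ofMul (hV v.toMul)
  obtain ⟨U, hU, hWU⟩ := AddSubgroup.exists_isCompl_of_iterate_eq_self (p := p) hN T.toAdditive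
    hT (Subgroup.toAddSubgroup W) hW
  refine ⟨Subgroup.toAddSubgroup.symm U, hU, ?_⟩
  rwa [Subgroup.toAddSubgroup.isCompl_iff, OrderIso.apply_symm_apply]

lemma IsCoatom.isSimpleGroup_quotient {G : Type*} [Group G] {M : Subgroup G} [M.Normal]
    (hM : IsCoatom M) : IsSimpleGroup (G ⧸ M) where
  toNontrivial := QuotientGroup.nontrivial_iff.2 hM.1
  eq_bot_or_eq_top_of_normal K _ := by
    have hs := QuotientGroup.mk'_surjective M
    rcases hM.le_iff.1 (QuotientGroup.le_comap_mk' M K) with h | h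
    · exact .inr (Subgroup.comap_injective hs (h.trans (Subgroup.comap_top _).symm))
    · left
      apply Subgroup.comap_injective hs
      rw [h, MonoidHom.comap_bot, QuotientGroup.ker_mk']

lemma IsPGroup.card_quotient_of_isCoatom {P : Type*} [Group P] [Finite P] {p : ℕ}
    [hp : Fact p.Prime] (hP : IsPGroup p P) {M : Subgroup P} [M.Normal] (hM : IsCoatom M) :
    Nat.card (P ⧸ M) = p := by
  have := hM.isSimpleGroup_quotient
  have hPM := hP.to_quotient M
  have := hPM.isNilpotent
  have hprime : (Nat.card (P ⧸ M)).Prime := IsSimpleGroup.prime_card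
  obtain ⟨n, hn⟩ := IsPGroup.iff_card.1 hPM
  rw [hn] at hprime ⊢
  rw [hprime.eq_one_of_pow, pow_one]

lemma IsPGroup.normal_of_isCoatom {P : Type*} [Group P] [Finite P] {p : ℕ}
    [hp : Fact p.Prime] (hP : IsPGroup p P) {M : Subgroup P} (hM : IsCoatom M) : M.Normal := by
  have := hP.isNilpotent
  exact Subgroup.NormalizerCondition.normal_of_coatom M Group.normalizerCondition_of_isNilpotent hM

lemma mem_frattini_iff {G : Type*} [Group G] {g : G} :
    g ∈ frattini G ↔ ∀ M : Subgroup G, IsCoatom M → g ∈ M := by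
  simp [frattini, Order.radical, Subgroup.mem_iInf]

lemma IsPGroup.pow_mem_frattini {P : Type*} [Group P] [Finite P] {p : ℕ}
    [hp : Fact p.Prime] (hP : IsPGroup p P) (g : P) : g ^ p ∈ frattini P := by
  refine mem_frattini_iff.2 fun M hM => ?_
  have := hP.normal_of_isCoatom hM
  rw [← QuotientGroup.eq_one_iff, QuotientGroup.mk_pow, ← hP.card_quotient_of_isCoatom hM,
    pow_card_eq_one']

lemma IsPGroup.quotient_frattini_mul_comm {P : Type*} [Group P] [Finite P] {p : ℕ}
    [hp : Fact p.Prime] (hP : IsPGroup p P) (a b : P ⧸ frattini P) : a * b = b * a := by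
  induction a using QuotientGroup.induction_on with | _ a
  induction b using QuotientGroup.induction_on with | _ b
  rw [← QuotientGroup.mk_mul, ← QuotientGroup.mk_mul, QuotientGroup.eq]
  refine mem_frattini_iff.2 fun M hM => ?_
  have := hP.normal_of_isCoatom hM
  have := isCyclic_of_prime_card (hP.card_quotient_of_isCoatom hM)
  rw [← QuotientGroup.eq, QuotientGroup.mk_mul, QuotientGroup.mk_mul]
  exact (IsCyclic.isMulCommutative (α := P ⧸ M)).is_comm.comm _ _

lemma Sylow.normal_of_sup_frattini_normal {G : Type*} [Group G] [Finite G] {p : ℕ}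
    [Fact p.Prime] (P : Sylow p G) (h : ((P : Subgroup G) ⊔ frattini G).Normal) :
    (P : Subgroup G).Normal := by
  have h1 := P.normalizer_sup_eq_top' (N := (P : Subgroup G) ⊔ frattini G) le_sup_left
  have h2 : (P : Subgroup G) ≤ Subgroup.normalizer (P : Set G) := Subgroup.le_normalizer
  rw [← sup_assoc, sup_of_le_left h2] at h1
  exact Subgroup.normalizer_eq_top_iff.1 (frattini_nongenerating h1)

lemma IsPGroup.le_of_not_dvd_index {G : Type*} [Group G] {r : ℕ} [hr : Fact r.Prime]
    {R : Subgroup G} (hR : IsPGroup r R) {N : Subgroup G} [N.Normal] (hN : ¬ r ∣ N.index) :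
    R ≤ N := by
  intro x hx
  obtain ⟨k, hk⟩ := hR ⟨x, hx⟩
  have hk' : x ^ r ^ k = 1 := congrArg Subtype.val hk
  have h1 : orderOf (x : G ⧸ N) ∣ r ^ k :=
    orderOf_dvd_of_pow_eq_one (by rw [← QuotientGroup.mk_pow, hk', QuotientGroup.mk_one])
  rw [← QuotientGroup.eq_one_iff, ← orderOf_eq_one_iff]
  exact Nat.eq_one_of_dvd_coprimes (((Nat.Prime.coprime_iff_not_dvd hr.out).2 hN).pow_left k) h1
    (orderOf_dvd_natCard _)

lemma dvd_index_frattini_of_prime_dvd_card {G : Type*} [Group G] [Finite G] {r : ℕ}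
    (hr : r.Prime) (h : r ∣ Nat.card G) : r ∣ (frattini G).index := by
  by_contra hF
  have : Fact r.Prime := ⟨hr⟩
  obtain ⟨R⟩ : Nonempty (Sylow r G) := inferInstance
  have hRF : (R : Subgroup G) ≤ frattini G := R.isPGroup'.le_of_not_dvd_index hF
  have := R.normal_of_sup_frattini_normal (by rw [sup_of_le_right hRF]; infer_instance)
  obtain ⟨C, hC⟩ := Subgroup.exists_right_complement'_of_coprime R.card_coprime_index
  have hCtop : C = ⊤ := frattini_nongenerating
    (top_le_iff.1 (hC.sup_eq_top.ge.trans (sup_comm (R : Subgroup G) C ▸ sup_le_sup_left hRF C)))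
  have := hC.disjoint
  rw [hCtop, disjoint_top] at this
  exact R.ne_bot_of_dvd_card h this

lemma Subgroup.isCyclic_of_le_zpowers_sup_frattini {G : Type*} [Group G] [Finite G] {p : ℕ}
    [Fact p.Prime] {P Q : Subgroup G} [P.Normal] (hP : IsPGroup p P) (hidx : ¬ p ∣ P.index)
    (hPQ : Disjoint P Q) (hsup : P ⊔ Q = ⊤) {x y : G} (hx : x ∈ P)
    (hxP : P ≤ zpowers x ⊔ frattini G) (hy : zpowers y ⊔ P = ⊤) : IsCyclic P := by
  let _ : CommGroup (P ⧸ frattini P) :=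
    { (inferInstance : Group (P ⧸ frattini P)) with mul_comm := hP.quotient_frattini_mul_comm }
  let π : P →* P ⧸ frattini P := QuotientGroup.mk' (frattini P)
  have hπ : Function.Surjective π := QuotientGroup.mk'_surjective _
  let c : P →* P := (MulAut.conjNormal y).toMonoidHom
  let T : P ⧸ frattini P →* P ⧸ frattini P :=
    QuotientGroup.map _ _ c
      (frattini_le_comap_frattini_of_surjective (MulAut.conjNormal y).surjective)
  have hcN (n : ℕ) (v : P) : ((c^[n] v : P) : G) = y ^ n * v * (y ^ n)⁻¹ := by
    induction n with
    | zero => simp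
    | succ n ih =>
      rw [Function.iterate_succ_apply', pow_succ']
      change y * ((c^[n] v : P) : G) * y⁻¹ = _
      rw [ih]
      group
  have hTN (v : P ⧸ frattini P) : T^[P.index] v = v := by
    obtain ⟨v, rfl⟩ := hπ v
    have h1 (n : ℕ) : T^[n] (π v) = π (c^[n] v) :=
      (Function.Semiconj.iterate_right (f := π) (ga := c) (gb := T) (fun _ => rfl) n v).symm
    let z : P := ⟨y ^ P.index, P.pow_index_mem y⟩
    have h2 : c^[P.index] v = z * v * z⁻¹ := Subtype.ext (hcN _ v)
    rw [h1, h2, map_mul, map_mul, map_inv, mul_comm (π z), mul_inv_cancel_right]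
  obtain ⟨U, hUT, hWU⟩ := exists_isCompl_of_iterate_eq_self (p := p)
    (fun v => by
      obtain ⟨v, rfl⟩ := hπ v
      rw [← map_pow]
      exact (QuotientGroup.eq_one_iff _).2 (hP.pow_mem_frattini v))
    hidx T hTN (((frattini G).subgroupOf P).map π) (by
      rintro _ ⟨v, hv, rfl⟩
      exact ⟨c v, (inferInstance : (frattini G).Normal).conj_mem _ hv y, rfl⟩)
  let U' : Subgroup G := (U.comap π).map P.subtype
  have hU'P : U' ≤ P := Subgroup.map_subtype_le _
  have hconj (g : G) (hg : ∀ v : P, π v ∈ U → π (MulAut.conjNormal g v) ∈ U) :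
      g ∈ normalizer (U' : Set G) := by
    refine mem_normalizer_fintype ?_
    rintro _ ⟨v, hv, rfl⟩
    exact ⟨_, hg v hv, MulAut.conjNormal_apply g v⟩
  have hU' : U'.Normal := by
    rw [← normalizer_eq_top_iff, eq_top_iff, ← hy, sup_le_iff, zpowers_le]
    refine ⟨hconj y fun v hv => hUT hv, fun g hg => hconj g fun v hv => ?_⟩
    have h2 : MulAut.conjNormal g v = (⟨g, hg⟩ : P) * v * (⟨g, hg⟩ : P)⁻¹ := Subtype.ext rfl
    rwa [h2, map_mul, map_mul, map_inv, mul_comm (π ⟨g, hg⟩), mul_inv_cancel_right]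
  have hPU : P ≤ U' ⊔ frattini G := by
    intro g hg
    have h1 : π ⟨g, hg⟩ ∈ ((frattini G).subgroupOf P).map π ⊔ U := hWU.sup_eq_top ▸ mem_top _
    obtain ⟨_, ⟨a, ha, rfl⟩, u, hu, hau⟩ := Subgroup.mem_sup.1 h1
    have h2 : ((a⁻¹ * ⟨g, hg⟩ : P) : G) ∈ U' :=
      ⟨a⁻¹ * ⟨g, hg⟩, by
        rwa [SetLike.mem_coe, mem_comap, map_mul, map_inv, ← hau, inv_mul_cancel_left], rfl⟩
    have h3 : g = a * ((a⁻¹ * ⟨g, hg⟩ : P) : G) := by simp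
    rw [h3]
    exact mul_mem (mem_sup_right ha) (mem_sup_left h2)
  have hUQ : U' ⊔ Q = ⊤ := by
    refine frattini_nongenerating (top_le_iff.1 (hsup.ge.trans (sup_le ?_ ?_)))
    · exact hPU.trans (sup_le_sup_right le_sup_left _)
    · exact le_sup_right.trans le_sup_left
  have hPU' : P ≤ U' := by
    intro g hg
    obtain ⟨u, hu, s, hs, rfl⟩ := mem_sup_of_normal_left.1 (hUQ ▸ mem_top g)
    have hsP : s ∈ P := (P.mul_mem_cancel_left (hU'P hu)).1 hg
    rwa [Subgroup.disjoint_def.1 hPQ hsP hs, mul_one]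
  have hU : U = ⊤ := by
    refine eq_top_iff.2 fun v _ => ?_
    obtain ⟨v, rfl⟩ := hπ v
    obtain ⟨w, hw, hwv⟩ := hPU' v.2
    rwa [← Subtype.ext hwv]
  have hW : (frattini G).subgroupOf P ≤ frattini P := by
    have h1 := hWU.disjoint
    rw [hU, disjoint_top, Subgroup.map_eq_bot_iff] at h1
    rwa [QuotientGroup.ker_mk'] at h1
  have hgen : zpowers (⟨x, hx⟩ : P) = ⊤ := by
    refine frattini_nongenerating (top_le_iff.1 fun g _ => ?_)
    obtain ⟨_, ⟨k, rfl⟩, f, hf, hg⟩ := mem_sup_of_normal_right.1 (hxP g.2)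
    have hfP : f ∈ P := (P.mul_mem_cancel_left (zpow_mem hx k)).1 (by rw [hg]; exact g.2)
    have : g = (⟨x, hx⟩ : P) ^ k * ⟨f, hfP⟩ := Subtype.ext hg.symm
    rw [this]
    exact mul_mem (mem_sup_left (zpow_mem_zpowers _ k)) (mem_sup_right (hW hf))
  exact isCyclic_iff_exists_zpowers_eq_top.2 ⟨_, hgen⟩

/-- If $G$ is a finite group with $G/\Phi(G)$ isomorphic to a non-trivial semidirect
product $\mathbb{Z}_p \rtimes \mathbb{Z}_q$ for distinct primes $p, q$, then $G$ has a
normal cyclic Sylow $p$-subgroup of order $p^m$ and a cyclic Sylow $q$-subgroup of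
order $q^n$, and $G$ is their internal semidirect product. -/
theorem stmt_0 {G : Type*} [Group G] [Finite G] {p q : ℕ} (hp : p.Prime) (hq : q.Prime)
    (hpq : p ≠ q)
    (φ : Multiplicative (ZMod q) →* MulAut (Multiplicative (ZMod p))) (hφ : φ ≠ 1)
    (hiso : Nonempty ((G ⧸ frattini G) ≃*
      (Multiplicative (ZMod p) ⋊[φ] Multiplicative (ZMod q)))) :
    ∃ (P : Sylow p G) (Q : Sylow q G) (m n : ℕ),
      (P : Subgroup G).Normal ∧ IsCyclic ↥(P : Subgroup G) ∧ IsCyclic ↥(Q : Subgroup G) ∧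
      Nat.card ↥(P : Subgroup G) = p ^ m ∧ Nat.card ↥(Q : Subgroup G) = q ^ n ∧
      Disjoint (P : Subgroup G) (Q : Subgroup G) ∧
      (P : Subgroup G) ⊔ (Q : Subgroup G) = ⊤ := by
  have : Fact p.Prime := ⟨hp⟩
  have : Fact q.Prime := ⟨hq⟩
  obtain ⟨e⟩ := hiso
  let f : G →* Multiplicative (ZMod p) ⋊[φ] Multiplicative (ZMod q) :=
    e.toMonoidHom.comp (QuotientGroup.mk' (frattini G))
  have hf : Function.Surjective f := e.surjective.comp (QuotientGroup.mk'_surjective _)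
  have hker (g : G) : f g = 1 ↔ g ∈ frattini G :=
    (map_eq_one_iff e e.injective).trans (QuotientGroup.eq_one_iff g)
  have hF : (frattini G).index = p * q := by
    rw [Subgroup.index, Nat.card_congr e.toEquiv, SemidirectProduct.card]
    simp
  let ρ : G →* Multiplicative (ZMod q) := SemidirectProduct.rightHom.comp f
  have hρ : Function.Surjective ρ := SemidirectProduct.rightHom_surjective.comp hf
  have hρidx : ρ.ker.index = q := by
    rw [Subgroup.index_ker, MonoidHom.range_eq_top.2 hρ]
    simp
  have hFρ : frattini G ≤ ρ.ker := fun g hg => by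
    change (f g).right = 1
    rw [(hker g).2 hg, SemidirectProduct.one_right]
  obtain ⟨P⟩ : Nonempty (Sylow p G) := inferInstance
  obtain ⟨Q⟩ : Nonempty (Sylow q G) := inferInstance
  have hPρ : (P : Subgroup G) ≤ ρ.ker := P.isPGroup'.le_of_not_dvd_index
    (by rwa [hρidx, Nat.prime_dvd_prime_iff_eq hp hq])
  have hsplit {g : G} (hg : g ∈ ρ.ker) : f g = SemidirectProduct.inl (f g).left :=
    SemidirectProduct.ext (by simp) hg
  obtain ⟨x, hxP, hxF⟩ : ∃ x ∈ (P : Subgroup G), x ∉ frattini G := by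
    by_contra! h
    refine P.not_dvd_index ((Dvd.intro _ hF.symm).trans (Subgroup.index_dvd_of_le h))
  have hρx : ρ.ker ≤ Subgroup.zpowers x ⊔ frattini G := by
    intro g hg
    have hx1 : (f x).left ≠ 1 := fun h => hxF ((hker x).1 (by rw [hsplit (hPρ hxP), h, map_one]))
    obtain ⟨k, hk⟩ := Subgroup.mem_zpowers_iff.1
      (mem_zpowers_of_prime_card (p := p) (by simp) hx1 : (f g).left ∈ _)
    have h1 : f (x ^ k) = f g := by
      rw [map_zpow, hsplit hg, ← hk, hsplit (hPρ hxP), ← map_zpow, SemidirectProduct.left_inl]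
    have h2 : (x ^ k)⁻¹ * g ∈ frattini G :=
      (hker _).1 (by rw [map_mul, map_inv, h1, inv_mul_cancel])
    rw [← mul_inv_cancel_left (x ^ k) g]
    exact mul_mem (Subgroup.mem_sup_left (Subgroup.zpow_mem_zpowers x k))
      (Subgroup.mem_sup_right h2)
  have hPF : (P : Subgroup G) ⊔ frattini G = ρ.ker := le_antisymm (sup_le hPρ hFρ)
    (hρx.trans (sup_le_sup_right (by rwa [Subgroup.zpowers_le]) _))
  have hPn : (P : Subgroup G).Normal :=
    P.normal_of_sup_frattini_normal (by rw [hPF]; infer_instance)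
  obtain ⟨y, hy⟩ := hρ (Multiplicative.ofAdd 1)
  have hyP : Subgroup.zpowers y ⊔ (P : Subgroup G) = ⊤ := by
    refine frattini_nongenerating ?_
    rw [sup_assoc, hPF, eq_top_iff]
    intro g _
    have hy1 : ρ y ≠ 1 := by
      rw [hy, Ne, ofAdd_eq_one]
      exact one_ne_zero
    obtain ⟨k, hk⟩ := Subgroup.mem_zpowers_iff.1
      (mem_zpowers_of_prime_card (p := q) (by simp) hy1 : ρ g ∈ _)
    have h2 : (y ^ k)⁻¹ * g ∈ ρ.ker := by
      rw [MonoidHom.mem_ker, map_mul, map_inv, map_zpow, hk, inv_mul_cancel]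
    rw [← mul_inv_cancel_left (y ^ k) g]
    exact mul_mem (Subgroup.mem_sup_left (Subgroup.zpow_mem_zpowers y k))
      (Subgroup.mem_sup_right h2)
  have hdisj : Disjoint (P : Subgroup G) (Q : Subgroup G) :=
    IsPGroup.disjoint_of_ne p q hpq _ _ P.isPGroup' Q.isPGroup'
  have hPidx : (P : Subgroup G).index = q ^ (P : Subgroup G).index.primeFactorsList.length := by
    refine Nat.eq_prime_pow_of_unique_prime_dvd Subgroup.index_ne_zero_of_finite
      fun {r} hr hrP => ?_
    have h1 := dvd_index_frattini_of_prime_dvd_card hr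
      (hrP.trans (Subgroup.index_dvd_card (P : Subgroup G)))
    rw [hF, hr.dvd_mul, Nat.prime_dvd_prime_iff_eq hr hp, Nat.prime_dvd_prime_iff_eq hr hq] at h1
    refine h1.resolve_left ?_
    rintro rfl
    exact P.not_dvd_index hrP
  have hsup : (P : Subgroup G) ⊔ (Q : Subgroup G) = ⊤ := by
    rw [← Subgroup.index_eq_one]
    refine Nat.eq_one_of_dvd_coprimes (a := (P : Subgroup G).index) (b := (Q : Subgroup G).index) ?_
      (Subgroup.index_dvd_of_le le_sup_left) (Subgroup.index_dvd_of_le le_sup_right)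
    rw [hPidx]
    exact ((Nat.Prime.coprime_iff_not_dvd hq).2 Q.not_dvd_index).pow_left _
  have hcyc : IsCyclic (G ⧸ (P : Subgroup G)) := by
    refine ⟨y, fun g => ?_⟩
    obtain ⟨g, rfl⟩ := QuotientGroup.mk_surjective g
    obtain ⟨_, ⟨k, rfl⟩, h, hh, rfl⟩ :=
      Subgroup.mem_sup_of_normal_right.1 (hyP ▸ Subgroup.mem_top g)
    refine ⟨k, ?_⟩
    simp [(QuotientGroup.eq_one_iff h).2 hh]
  obtain ⟨m, hm⟩ := IsPGroup.iff_card.1 P.isPGroup'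
  obtain ⟨n, hn⟩ := IsPGroup.iff_card.1 Q.isPGroup'
  refine ⟨P, Q, m, n, hPn, ?_, ?_, hm, hn, hdisj, hsup⟩
  · exact Subgroup.isCyclic_of_le_zpowers_sup_frattini P.isPGroup' P.not_dvd_index hdisj hsup hxP
      (hPρ.trans hρx) hyP
  · refine isCyclic_of_injective
      ((QuotientGroup.mk' (P : Subgroup G)).comp (Q : Subgroup G).subtype)
      ((injective_iff_map_eq_one _).2 fun s hs => Subtype.ext ?_)
    exact Subgroup.disjoint_def.1 hdisj ((QuotientGroup.eq_one_iff _).1 hs) s.2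
end

section
/- Let G be a finite group such that G/Φ(G) is isomorphic to the alternating group A₅. If G is para-Nil-Hamiltonian, then G is isomorphic to A₅ or to SL(2,5). -/
open Subgroup
open Matrix (SpecialLinearGroup)
open scoped commutatorElement

/-- In a nilpotent group, elements of coprime orders commute. -/
theorem Group.IsNilpotent.commute_of_coprime {G : Type*} [Group G] [Group.IsNilpotent G] {x y : G}
    {m n : ℕ} (hx : x ^ m = 1) (hy : y ^ n = 1) (hmn : m.Coprime n) : Commute x y := by
  revert x y
  refine Group.nilpotent_center_quotient_ind
    (P := fun G _ _ => ∀ {x y : G}, x ^ m = 1 → y ^ n = 1 → Commute x y) G ?_ ?_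
  · intro G _ _ x y _ _
    exact Subsingleton.elim _ _
  · intro G _ _ ih x y hx hy
    have hcomm : Commute (x : G ⧸ center G) (y : G ⧸ center G) :=
      ih (by rw [← QuotientGroup.mk_pow, hx]; rfl) (by rw [← QuotientGroup.mk_pow, hy]; rfl)
    have hc : ⁅x, y⁆ ∈ center G := by
      rw [← QuotientGroup.eq_one_iff]
      exact commutatorElement_eq_one_iff_commute.mpr hcomm
    have hcy : x * y * x⁻¹ = ⁅x, y⁆ * y := by simp [commutatorElement_def]
    have hcx : y * x⁻¹ * y⁻¹ = x⁻¹ * ⁅x, y⁆ := by simp [commutatorElement_def, mul_assoc]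
    have hn : ⁅x, y⁆ ^ n = 1 := by
      have h := congrArg (· ^ n) hcy
      simp only [conj_pow, hy, mul_one, mul_inv_cancel] at h
      rw [(Commute.mul_pow (mem_center_iff.mp hc y).symm), hy, mul_one] at h
      exact h.symm
    have hm : ⁅x, y⁆ ^ m = 1 := by
      have h := congrArg (· ^ m) hcx
      simp only [conj_pow, inv_pow, hx, inv_one, mul_one, mul_inv_cancel] at h
      rw [(Commute.mul_pow (mem_center_iff.mp hc x⁻¹)), inv_pow, hx, inv_one, one_mul] at h
      exact h.symm
    rw [← commutatorElement_eq_one_iff_commute, ← orderOf_eq_one_iff]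
    exact Nat.eq_one_of_dvd_coprimes hmn (orderOf_dvd_of_pow_eq_one hm)
      (orderOf_dvd_of_pow_eq_one hn)

/-- The transfer into the abelianization of `H` kills a perfect group, and sends a central element
`z` to the class of `z ^ H.index`. -/
theorem pow_index_mem_map_commutator {E : Type*} [Group E] (hE : commutator E = ⊤)
    (H : Subgroup E) [H.FiniteIndex] {z : E} (hz : z ∈ center E) :
    z ^ H.index ∈ (commutator H).map H.subtype := by
  have key : ∀ (k : ℕ) (g : E), g⁻¹ * z ^ k * g ∈ H → g⁻¹ * z ^ k * g = z ^ k := by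
    intro k g _
    rw [mul_assoc, ← mem_center_iff.mp (pow_mem hz k) g, inv_mul_cancel_left]
  have h := MonoidHom.transfer_eq_pow (Abelianization.of : H →* Abelianization H) z key
  have hker : z ∈ (MonoidHom.transfer (Abelianization.of : H →* Abelianization H)).ker :=
    Abelianization.commutator_subset_ker _ (hE ▸ mem_top z)
  rw [MonoidHom.mem_ker.mp hker] at h
  exact ⟨_, Abelianization.ker_of H ▸ MonoidHom.mem_ker.mpr h.symm, rfl⟩

theorem commutator_le_commutator_of_sup_center {E : Type*} [Group E] {D : Subgroup E}
    (h : D ⊔ center E = ⊤) : commutator E ≤ ⁅D, D⁆ := by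
  have hdec : ∀ u : E, ∃ d ∈ D, ∃ z ∈ center E, d * z = u := fun u =>
    mem_sup_of_normal_right.mp (h ▸ mem_top u)
  rw [commutator_def, commutator_le]
  intro u _ v _
  obtain ⟨d, hd, z, hz, rfl⟩ := hdec u
  obtain ⟨d', hd', z', hz', rfl⟩ := hdec v
  have : ⁅d * z, d' * z'⁆ = ⁅d, d'⁆ := by
    have h1 := mem_center_iff.mp hz
    have h2 := mem_center_iff.mp hz'
    have e1 : d * z * (d' * z') = d * d' * (z * z') := by
      rw [mul_assoc, ← mul_assoc z, ← h1 d']; simp only [mul_assoc]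
    have e2 : d' * z' * (d * z) = d' * d * (z * z') := by
      rw [mul_assoc, ← mul_assoc z', ← h2 d]; simp only [mul_assoc]; rw [h1 z']
    have e : ∀ a b : E, ⁅a, b⁆ = (a * b) * (b * a)⁻¹ := fun a b => by group
    rw [e, e, e1, e2]
    group
  rw [this]
  exact commutator_mem_commutator hd hd'

theorem commutator_commutator_eq_top {E Q : Type*} [Group E] [Group Q] {f : E →* Q}
    (hker : f.ker ≤ center E) (hmap : (commutator E).map f = ⊤) :
    commutator (commutator E) = ⊤ := by
  have h : commutator E ⊔ center E = ⊤ := by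
    rw [eq_top_iff]
    intro u _
    obtain ⟨d, hd, hdu⟩ := hmap.ge (mem_top (f u))
    rw [← mul_inv_cancel_left d u]
    exact mul_mem_sup hd (hker (by simp [MonoidHom.mem_ker, hdu]))
  apply map_injective (commutator E).subtype_injective
  rw [map_commutator_eq, ← MonoidHom.range_eq_map, range_subtype]
  exact le_antisymm (commutator_le_left _ _) (commutator_le_commutator_of_sup_center h)

theorem nat_card_alternatingGroup_five : Nat.card (alternatingGroup (Fin 5)) = 60 := by
  rw [nat_card_alternatingGroup]
  simp [Nat.factorial]

/-- The double transposition `(0 1)(2 3)`. -/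
def doubleSwap : alternatingGroup (Fin 5) :=
  ⟨c[0, 1] * c[2, 3], Equiv.Perm.mem_alternatingGroup.mpr (by decide)⟩

/-- The double transposition `(0 2)(1 3)`. -/
def doubleSwap₂ : alternatingGroup (Fin 5) :=
  ⟨c[0, 2] * c[1, 3], Equiv.Perm.mem_alternatingGroup.mpr (by decide)⟩

/-- The three-cycle `(0 1 2)`. -/
def threeCycle : alternatingGroup (Fin 5) :=
  ⟨c[0, 1, 2], Equiv.Perm.mem_alternatingGroup.mpr (by decide)⟩

/-- The five-cycle `(0 1 2 3 4)`. -/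
def fiveCycle : alternatingGroup (Fin 5) :=
  ⟨c[0, 1, 2, 3, 4], Equiv.Perm.mem_alternatingGroup.mpr (by decide)⟩

theorem orderOf_threeCycle : orderOf threeCycle = 3 :=
  orderOf_eq_prime (by decide) (by decide)

theorem orderOf_fiveCycle : orderOf fiveCycle = 5 :=
  have := Fact.mk Nat.prime_five
  orderOf_eq_prime (by decide +kernel) (by decide)

section CentralExtension

variable {E : Type*} [Group E] {f : E →* alternatingGroup (Fin 5)}

theorem commutator_comap_zpowers_eq_bot (hker : f.ker ≤ center E) (x : alternatingGroup (Fin 5)) :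
    commutator ((zpowers x).comap f) = ⊥ := by
  have hc := (MonoidHom.isMulCommutative_of_isCyclic_of_ker_le_center
    (f.subgroupComap (zpowers x)) fun u hu => mem_center_iff.mpr fun v => Subtype.ext <| by
      have : (u : E) ∈ f.ker := congrArg Subtype.val hu
      exact mem_center_iff.mp (hker this) v).is_comm.comm
  rw [eq_bot_iff, commutator_def, commutator_le]
  intro u _ v _
  exact commutatorElement_eq_one_iff_mul_comm.mpr (hc u v)

theorem pow_index_zpowers_eq_one [Finite E] (hf : Function.Surjective f) (hker : f.ker ≤ center E)
    (hE : commutator E = ⊤) (x : alternatingGroup (Fin 5)) {z : E} (hz : z ∈ f.ker) :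
    z ^ (zpowers x).index = 1 := by
  have h := pow_index_mem_map_commutator hE ((zpowers x).comap f) (hker hz)
  rwa [commutator_comap_zpowers_eq_bot hker, Subgroup.map_bot, mem_bot,
    index_comap_of_surjective _ hf] at h

/-- A Klein four-group inside `A₅`. -/
def kleinFour : Subgroup (alternatingGroup (Fin 5)) where
  carrier := {1, doubleSwap, doubleSwap₂, doubleSwap * doubleSwap₂}
  one_mem' := Or.inl rfl
  mul_mem' := by
    simp only [Set.mem_insert_iff, Set.mem_singleton_iff]
    rintro _ _ (rfl | rfl | rfl | rfl) (rfl | rfl | rfl | rfl) <;> decide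
  inv_mem' := by
    simp only [Set.mem_insert_iff, Set.mem_singleton_iff]
    rintro _ (rfl | rfl | rfl | rfl) <;> decide

theorem index_kleinFour : kleinFour.index = 15 := by
  have h := kleinFour.card_mul_index
  have hset : (kleinFour : Set (alternatingGroup (Fin 5))) =
      ({1, doubleSwap, doubleSwap₂, doubleSwap * doubleSwap₂} :
        Finset (alternatingGroup (Fin 5))) := by
    simp only [Finset.coe_insert, Finset.coe_singleton]
    rfl
  have hcard : Nat.card kleinFour = 4 := by
    change Nat.card (kleinFour : Set (alternatingGroup (Fin 5))) = 4
    rw [hset, Nat.card_coe_set_eq, Set.ncard_coe_finset]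
    decide
  rw [nat_card_alternatingGroup_five, hcard] at h
  omega

/-- In a central extension of `A₅`, the derived subgroup of the preimage of a Klein four-group has
order at most two. -/
theorem exists_map_commutator_kleinFour_le (hf : Function.Surjective f) (hker : f.ker ≤ center E) :
    ∃ c : E, c ^ 2 = 1 ∧
      (commutator (kleinFour.comap f)).map (kleinFour.comap f).subtype ≤ zpowers c := by
  obtain ⟨a, ha⟩ := hf doubleSwap
  obtain ⟨b, hb⟩ := hf doubleSwap₂
  have hcker : ⁅a, b⁆ ∈ f.ker := by
    rw [MonoidHom.mem_ker, map_commutatorElement, ha, hb]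
    decide
  have hc := mem_center_iff.mp (hker hcker)
  have ha2 : a ^ 2 ∈ f.ker := by
    rw [MonoidHom.mem_ker, map_pow, ha]
    decide
  have hac : a * b * a⁻¹ = ⁅a, b⁆ * b := by simp [commutatorElement_def]
  refine ⟨⁅a, b⁆, ?_, ?_⟩
  · have h1 : a ^ 2 * b * (a ^ 2)⁻¹ = ⁅a, b⁆ ^ 2 * b := by
      calc a ^ 2 * b * (a ^ 2)⁻¹ = a * (a * b * a⁻¹) * a⁻¹ := by
            simp only [pow_two, mul_inv_rev, mul_assoc]
        _ = (a * ⁅a, b⁆) * b * a⁻¹ := by rw [hac]; simp only [mul_assoc]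
        _ = ⁅a, b⁆ * (a * b * a⁻¹) := by rw [hc a]; simp only [mul_assoc]
        _ = ⁅a, b⁆ ^ 2 * b := by rw [hac, pow_two, mul_assoc]
    rw [← mem_center_iff.mp (hker ha2) b, mul_inv_cancel_right] at h1
    exact mul_eq_right.mp h1.symm
  · have hnormal : (zpowers ⁅a, b⁆).Normal :=
      ⟨fun n hn g => by
        rwa [mem_center_iff.mp (zpowers_le.mpr (hker hcker) hn) g, mul_inv_cancel_right]⟩
    let q := QuotientGroup.mk' (zpowers ⁅a, b⁆)
    have hab : Commute (q a) (q b) := by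
      rw [← commutatorElement_eq_one_iff_commute, ← map_commutatorElement]
      exact (QuotientGroup.eq_one_iff _).mpr (mem_zpowers _)
    have hz : ∀ z ∈ f.ker, ∀ u, Commute (q z) (q u) := fun z hz u => by
      rw [commute_iff_eq, ← map_mul, ← map_mul, mem_center_iff.mp (hker hz) u]
    have hdec : ∀ u ∈ kleinFour.comap f, ∃ z ∈ f.ker, ∃ w,
        (w = 1 ∨ w = a ∨ w = b ∨ w = a * b) ∧ u = z * w := by
      intro u hu
      have key : ∃ w, (w = 1 ∨ w = a ∨ w = b ∨ w = a * b) ∧ f u = f w := by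
        rcases hu with hu | hu | hu | hu
        · exact ⟨1, by simp, by rw [hu, map_one]⟩
        · exact ⟨a, by simp, by rw [hu, ha]⟩
        · exact ⟨b, by simp, by rw [hu, hb]⟩
        · exact ⟨a * b, by simp, by rw [hu, map_mul, ha, hb]⟩
      obtain ⟨w, hw, hfw⟩ := key
      exact ⟨u * w⁻¹, by simp [MonoidHom.mem_ker, hfw], w, hw, by simp⟩
    rw [map_subtype_commutator, commutator_le]
    intro u hu v hv
    obtain ⟨z, hzk, w, hw, rfl⟩ := hdec u hu
    obtain ⟨z', hzk', w', hw', rfl⟩ := hdec v hv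
    rw [← QuotientGroup.eq_one_iff]
    change q ⁅_, _⁆ = 1
    rw [map_commutatorElement, commutatorElement_eq_one_iff_commute, map_mul]
    refine (hz z hzk _).mul_left ?_
    rw [map_mul]
    refine (hz z' hzk' _).symm.mul_right ?_
    rcases hw with rfl | rfl | rfl | rfl <;> rcases hw' with rfl | rfl | rfl | rfl <;>
      simp [hab, hab.symm, Commute.mul_left, Commute.mul_right]

/-- A perfect central extension of `A₅` has kernel of order at most two. -/
theorem card_ker_le_two [Finite E] (hf : Function.Surjective f) (hker : f.ker ≤ center E)
    (hE : commutator E = ⊤) : Nat.card f.ker ≤ 2 := by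
  obtain ⟨c, hc2, hc⟩ := exists_map_commutator_kleinFour_le hf hker
  have hle : f.ker ≤ zpowers c := by
    intro z hz
    have h15 := hc (pow_index_mem_map_commutator hE (kleinFour.comap f) (hker hz))
    rw [index_comap_of_surjective _ hf, index_kleinFour] at h15
    have h4 : z ^ 4 = 1 := by
      have hindex (x : alternatingGroup (Fin 5)) : orderOf x * (zpowers x).index = 60 := by
        rw [← Nat.card_zpowers, card_mul_index, nat_card_alternatingGroup_five]
      have i3 := hindex threeCycle
      have i5 := hindex fiveCycle
      rw [orderOf_threeCycle] at i3
      rw [orderOf_fiveCycle] at i5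
      have e20 := pow_index_zpowers_eq_one hf hker hE threeCycle hz
      have e12 := pow_index_zpowers_eq_one hf hker hE fiveCycle hz
      rw [show (zpowers threeCycle).index = 20 by omega] at e20
      rw [show (zpowers fiveCycle).index = 12 by omega] at e12
      exact orderOf_dvd_iff_pow_eq_one.mp <|
        Nat.dvd_gcd (orderOf_dvd_of_pow_eq_one e20) (orderOf_dvd_of_pow_eq_one e12)
    have : z = (z ^ 15)⁻¹ := by
      rw [eq_inv_iff_mul_eq_one, ← pow_succ', show 15 + 1 = 4 * 4 from rfl, pow_mul, h4, one_pow]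
    rw [this]
    exact inv_mem h15
  calc Nat.card f.ker ≤ Nat.card (zpowers c) := card_le_of_le hle
    _ = orderOf c := Nat.card_zpowers c
    _ ≤ 2 := Nat.le_of_dvd two_pos (orderOf_dvd_of_pow_eq_one hc2)

end CentralExtension

theorem map_commutator_of_surjective {E K : Type*} [Group E] [Group K] {p : E →* K}
    (hp : Function.Surjective p) : (commutator E).map p = commutator K := by
  rw [map_commutator_eq, MonoidHom.range_eq_top.mpr hp, commutator_def]

theorem nonempty_commutator_mulEquiv {E K : Type*} [Group E] [Finite E] [Group K] {p : E →* K}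
    (hp : Function.Surjective p) (hK : commutator K = ⊤)
    (hcard : Nat.card (commutator E) ≤ Nat.card K) : Nonempty (commutator E ≃* K) := by
  have hsurj : Function.Surjective (p.comp (commutator E).subtype) := by
    rw [← MonoidHom.range_eq_top, MonoidHom.range_comp, range_subtype,
      map_commutator_of_surjective hp, hK]
  exact ⟨MulEquiv.ofBijective _ <| (Nat.bijective_iff_surjective_and_card _).mpr
    ⟨hsurj, le_antisymm hcard (Nat.card_le_card_of_surjective _ hsurj)⟩⟩

/-- Two perfect central extensions of `A₅` of order 120 are isomorphic: both are isomorphic to the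
derived subgroup of their fibre product over `A₅`. -/
theorem exists_mulEquiv_of_perfect_central_extensions {G₁ G₂ : Type*} [Group G₁] [Group G₂]
    [Finite G₁] [Finite G₂] {f₁ : G₁ →* alternatingGroup (Fin 5)}
    {f₂ : G₂ →* alternatingGroup (Fin 5)} (hf₁ : Function.Surjective f₁)
    (hf₂ : Function.Surjective f₂) (hker₁ : f₁.ker ≤ center G₁) (hker₂ : f₂.ker ≤ center G₂)
    (hG₁ : commutator G₁ = ⊤) (hG₂ : commutator G₂ = ⊤) (hcard₁ : Nat.card G₁ = 120)
    (hcard₂ : Nat.card G₂ = 120) : Nonempty (G₁ ≃* G₂) := by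
  let E : Subgroup (G₁ × G₂) :=
    (f₁.comp (MonoidHom.fst G₁ G₂)).eqLocus (f₂.comp (MonoidHom.snd G₁ G₂))
  let p₁ : E →* G₁ := (MonoidHom.fst G₁ G₂).comp E.subtype
  let p₂ : E →* G₂ := (MonoidHom.snd G₁ G₂).comp E.subtype
  have hp₁ : Function.Surjective p₁ := fun g => by
    obtain ⟨s, hs⟩ := hf₂ (f₁ g)
    exact ⟨⟨(g, s), hs.symm⟩, rfl⟩
  have hp₂ : Function.Surjective p₂ := fun s => by
    obtain ⟨g, hg⟩ := hf₁ (f₂ s)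
    exact ⟨⟨(g, s), hg⟩, rfl⟩
  let F : E →* alternatingGroup (Fin 5) := f₁.comp p₁
  have hFker : F.ker ≤ center E := by
    intro u hu
    have h1 : f₁ u.1.1 = 1 := hu
    have h2 : f₂ u.1.2 = 1 := u.2.symm.trans hu
    refine mem_center_iff.mpr fun v => Subtype.ext (Prod.ext ?_ ?_)
    · exact mem_center_iff.mp (hker₁ h1) v.1.1
    · exact mem_center_iff.mp (hker₂ h2) v.1.2
  have hmapF : (commutator E).map F = ⊤ := by
    rw [← Subgroup.map_map, map_commutator_of_surjective hp₁, hG₁, ← MonoidHom.range_eq_map,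
      MonoidHom.range_eq_top.mpr hf₁]
  let D := commutator E
  have hD : commutator D = ⊤ := commutator_commutator_eq_top hFker hmapF
  have hDF : Function.Surjective (F.comp D.subtype) := by
    rw [← MonoidHom.range_eq_top, MonoidHom.range_comp, range_subtype, hmapF]
  have hDker : (F.comp D.subtype).ker ≤ center D := fun u hu =>
    mem_center_iff.mpr fun v => Subtype.ext (mem_center_iff.mp (hFker hu) v)
  have hcard : Nat.card D ≤ 120 := by
    have h := card_ker_le_two hDF hDker hD
    have h' := (F.comp D.subtype).ker.card_mul_index
    rw [index_ker, MonoidHom.range_eq_top.mpr hDF, card_top, nat_card_alternatingGroup_five] at h'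
    omega
  obtain ⟨e₁⟩ := nonempty_commutator_mulEquiv hp₁ hG₁ (hcard₁.symm ▸ hcard)
  obtain ⟨e₂⟩ := nonempty_commutator_mulEquiv hp₂ hG₂ (hcard₂.symm ▸ hcard)
  exact ⟨e₁.symm.trans e₂⟩

/-- The trace-zero matrices `!![2, i; 0, -2]` represent the five classes of mutually orthogonal
triples of elements of order four in `SL(2,5)`, up to sign. -/
def axisRep (i : ZMod 5) : Matrix (Fin 2) (Fin 2) (ZMod 5) := !![2, i; 0, -2]

/-- The label `i` of the class of a trace-zero matrix of determinant one. -/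
def axisLabel (y : Matrix (Fin 2) (Fin 2) (ZMod 5)) : ZMod 5 :=
  y 0 0 * y 1 0 ^ 3 + 3 * y 0 0 * y 0 1 * (1 - y 1 0 ^ 4)

theorem axisLabel_conj_aux : ∀ a b c : ZMod 5, a * (-a) - b * c = 1 → ∀ p q r s : ZMod 5,
    p * s - q * r = 1 →
    axisLabel (!![p, q; r, s] * !![a, b; c, -a] * !![s, -q; -r, p]) =
      axisLabel (!![p, q; r, s] * axisRep (axisLabel !![a, b; c, -a]) * !![s, -q; -r, p]) := by
  simp only [axisLabel, axisRep, Matrix.mul_fin_two, Matrix.of_apply, Matrix.cons_val',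
    Matrix.cons_val_zero, Matrix.cons_val_one, Matrix.cons_val_fin_one]
  decide +kernel

/-- Conjugation of a matrix by an element of `SL(2,5)`. -/
def conjMatrix (M : SpecialLinearGroup (Fin 2) (ZMod 5)) (y : Matrix (Fin 2) (Fin 2) (ZMod 5)) :
    Matrix (Fin 2) (Fin 2) (ZMod 5) :=
  (M : Matrix (Fin 2) (Fin 2) (ZMod 5)) * y * (M : Matrix (Fin 2) (Fin 2) (ZMod 5)).adjugate

theorem conjMatrix_eq (M : SpecialLinearGroup (Fin 2) (ZMod 5))
    (y : Matrix (Fin 2) (Fin 2) (ZMod 5)) :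
    conjMatrix M y = !![M 0 0, M 0 1; M 1 0, M 1 1] * y * !![M 1 1, -M 0 1; -M 1 0, M 0 0] := by
  rw [conjMatrix, Matrix.adjugate_fin_two, ← Matrix.eta_fin_two]

theorem conjMatrix_mul (M N : SpecialLinearGroup (Fin 2) (ZMod 5))
    (y : Matrix (Fin 2) (Fin 2) (ZMod 5)) :
    conjMatrix (M * N) y = conjMatrix M (conjMatrix N y) := by
  have h : ((M * N : SpecialLinearGroup (Fin 2) (ZMod 5)) : Matrix (Fin 2) (Fin 2) (ZMod 5)) =
    M * N := M.coe_mul N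
  simp only [conjMatrix, h, Matrix.adjugate_mul_distrib, mul_assoc]

theorem trace_conjMatrix (M : SpecialLinearGroup (Fin 2) (ZMod 5))
    (y : Matrix (Fin 2) (Fin 2) (ZMod 5)) : (conjMatrix M y).trace = y.trace := by
  rw [conjMatrix, Matrix.trace_mul_comm, ← mul_assoc, Matrix.adjugate_mul, M.det_coe, one_smul,
    one_mul]

theorem det_conjMatrix (M : SpecialLinearGroup (Fin 2) (ZMod 5))
    (y : Matrix (Fin 2) (Fin 2) (ZMod 5)) : (conjMatrix M y).det = y.det := by
  simp [conjMatrix, Matrix.det_adjugate]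

theorem axisLabel_conj (M : SpecialLinearGroup (Fin 2) (ZMod 5))
    {y : Matrix (Fin 2) (Fin 2) (ZMod 5)} (htr : y.trace = 0) (hdet : y.det = 1) :
    axisLabel (conjMatrix M y) = axisLabel (conjMatrix M (axisRep (axisLabel y))) := by
  have hM := M.det_coe
  rw [Matrix.det_fin_two] at hM hdet
  rw [Matrix.trace_fin_two, add_comm, add_eq_zero_iff_eq_neg] at htr
  rw [htr] at hdet
  have h := axisLabel_conj_aux _ _ _ hdet _ _ _ _ hM
  rwa [← htr, ← Matrix.eta_fin_two y, ← conjMatrix_eq, ← conjMatrix_eq] at h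

theorem axisLabel_axisRep : ∀ i, axisLabel (axisRep i) = i := by
  simp [axisLabel, axisRep]
  decide

/-- `SL(2,5)` acts on the five classes of axes by conjugation. -/
@[reducible]
def axisAction : MulAction (SpecialLinearGroup (Fin 2) (ZMod 5)) (ZMod 5) where
  smul M i := axisLabel (conjMatrix M (axisRep i))
  one_smul i := by
    change axisLabel (conjMatrix 1 (axisRep i)) = i
    simp [conjMatrix, axisLabel_axisRep]
  mul_smul M N i := by
    change axisLabel (conjMatrix (M * N) (axisRep i)) =
      axisLabel (conjMatrix M (axisRep (axisLabel (conjMatrix N (axisRep i)))))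
    rw [← axisLabel_conj, conjMatrix_mul]
    · rw [trace_conjMatrix]
      simp [axisRep, Matrix.trace_fin_two]
    · rw [det_conjMatrix, axisRep, Matrix.det_fin_two_of]
      decide +revert

/-- The permutation representation of `SL(2,5)` of degree five. -/
def slToPerm : SpecialLinearGroup (Fin 2) (ZMod 5) →* Equiv.Perm (Fin 5) :=
  @MulAction.toPermHom (SpecialLinearGroup (Fin 2) (ZMod 5)) (ZMod 5) _ axisAction

theorem slToPerm_apply (M : SpecialLinearGroup (Fin 2) (ZMod 5)) (i : ZMod 5) :
    slToPerm M i = axisLabel (conjMatrix M (axisRep i)) := rfl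

theorem slToPerm_ker_aux : ∀ p q r s : ZMod 5, p * s - q * r = 1 →
    (∀ i, axisLabel (!![p, q; r, s] * axisRep i * !![s, -q; -r, p]) = i) →
    q = 0 ∧ r = 0 ∧ s = p ∧ (p = 1 ∨ p = -1) := by
  simp only [axisLabel, axisRep, Matrix.mul_fin_two, Matrix.of_apply, Matrix.cons_val',
    Matrix.cons_val_zero, Matrix.cons_val_one, Matrix.cons_val_fin_one]
  decide +kernel

theorem eq_one_or_of_mem_ker_slToPerm {M : SpecialLinearGroup (Fin 2) (ZMod 5)}
    (hM : M ∈ slToPerm.ker) : M = 1 ∨ M = -1 := by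
  have hd := M.det_coe
  rw [Matrix.det_fin_two] at hd
  obtain ⟨hq, hr, hs, hp⟩ := slToPerm_ker_aux _ _ _ _ hd fun i => by
    rw [← conjMatrix_eq, ← slToPerm_apply, MonoidHom.mem_ker.mp hM]
    rfl
  rcases hp with hp | hp
  · left; ext i j; fin_cases i <;> fin_cases j <;> simp [hq, hr, hs, hp]
  · right; ext i j; fin_cases i <;> fin_cases j <;> simp [hq, hr, hs, hp]

theorem neg_one_mem_ker_slToPerm : (-1 : SpecialLinearGroup (Fin 2) (ZMod 5)) ∈ slToPerm.ker := by
  refine Equiv.ext fun i => ?_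
  have h : ∀ j, conjMatrix (-1) (axisRep j) = axisRep j := fun j => by
    simp [conjMatrix_eq, axisRep]
  exact (congrArg axisLabel (h i)).trans (axisLabel_axisRep i)

theorem card_specialLinearGroup_two_five :
    Nat.card (SpecialLinearGroup (Fin 2) (ZMod 5)) = 120 := by
  let e : SpecialLinearGroup (Fin 2) (ZMod 5) ≃
      {p : (ZMod 5 × ZMod 5) × ZMod 5 × ZMod 5 // p.1.1 * p.2.2 - p.1.2 * p.2.1 = 1} :=
    { toFun M := ⟨((M 0 0, M 0 1), M 1 0, M 1 1), by
        have h := M.2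
        rwa [Matrix.det_fin_two] at h⟩
      invFun p := ⟨!![p.1.1.1, p.1.1.2; p.1.2.1, p.1.2.2], by
        rw [Matrix.det_fin_two_of]; exact p.2⟩
      left_inv M := by ext i j; fin_cases i <;> fin_cases j <;> rfl
      right_inv p := rfl }
  rw [Nat.card_congr e, Nat.card_eq_fintype_card]
  decide +kernel

/-- The group `SL(2,5)` is a perfect central extension of `A₅`. -/
theorem exists_specialLinearGroup_hom :
    ∃ f : SpecialLinearGroup (Fin 2) (ZMod 5) →* alternatingGroup (Fin 5), Function.Surjective f ∧
      f.ker ≤ center (SpecialLinearGroup (Fin 2) (ZMod 5)) ∧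
      commutator (SpecialLinearGroup (Fin 2) (ZMod 5)) = ⊤ := by
  have hker : (slToPerm.ker : Set (SpecialLinearGroup (Fin 2) (ZMod 5))) = {1, -1} := by
    ext M
    refine ⟨eq_one_or_of_mem_ker_slToPerm, ?_⟩
    rintro (rfl | rfl)
    exacts [one_mem _, neg_one_mem_ker_slToPerm]
  have hne : (1 : SpecialLinearGroup (Fin 2) (ZMod 5)) ≠ -1 := fun h => by
    have := congrArg (fun M : SpecialLinearGroup (Fin 2) (ZMod 5) => M 0 0) h
    revert this
    simp
    decide
  have hcardker : Nat.card slToPerm.ker = 2 := by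
    change Nat.card (slToPerm.ker : Set (SpecialLinearGroup (Fin 2) (ZMod 5))) = 2
    rw [hker, Nat.card_coe_set_eq, Set.ncard_pair hne]
  have hrange : slToPerm.range = alternatingGroup (Fin 5) := by
    apply Equiv.Perm.eq_alternatingGroup_of_index_eq_two
    have h1 := slToPerm.ker.card_mul_index
    rw [hcardker, index_ker, card_specialLinearGroup_two_five] at h1
    have h2 := slToPerm.range.card_mul_index
    rw [Nat.card_perm, Nat.card_fin, show Nat.factorial 5 = 120 from rfl] at h2
    have h3 : Nat.card slToPerm.range = 60 := by omega
    rw [h3] at h2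
    omega
  let f : SpecialLinearGroup (Fin 2) (ZMod 5) →* alternatingGroup (Fin 5) :=
    slToPerm.codRestrict (alternatingGroup (Fin 5)) fun M => hrange.le ⟨M, rfl⟩
  have hf : Function.Surjective f := fun x => by
    obtain ⟨M, hM⟩ : (x : Equiv.Perm (Fin 5)) ∈ slToPerm.range := hrange.ge x.2
    exact ⟨M, Subtype.ext hM⟩
  have hfker : ∀ M ∈ f.ker, M = 1 ∨ M = -1 := fun M hM =>
    eq_one_or_of_mem_ker_slToPerm (congrArg Subtype.val hM)
  refine ⟨f, hf, fun M hM => mem_center_iff.mpr fun N => ?_, ?_⟩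
  · rcases hfker M hM with rfl | rfl <;> simp
  have hneg : (-1 : SpecialLinearGroup (Fin 2) (ZMod 5)) ∈
      commutator (SpecialLinearGroup (Fin 2) (ZMod 5)) := by
    let i : SpecialLinearGroup (Fin 2) (ZMod 5) := ⟨!![2, 0; 0, 3], by decide⟩
    let j : SpecialLinearGroup (Fin 2) (ZMod 5) := ⟨!![0, 1; -1, 0], by decide⟩
    have : ⁅i, j⁆ = -1 := by
      rw [commutatorElement_def, mul_inv_eq_iff_eq_mul, mul_inv_eq_iff_eq_mul]
      ext a b
      fin_cases a <;> fin_cases b <;> decide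
    rw [← this]
    exact commutator_mem_commutator (mem_top i) (mem_top j)
  have hle : f.ker ≤ commutator (SpecialLinearGroup (Fin 2) (ZMod 5)) := fun M hM => by
    rcases hfker M hM with rfl | rfl
    exacts [one_mem _, hneg]
  rw [← comap_map_eq_self hle, map_commutator_of_surjective hf,
    commutator_alternatingGroup_eq_top (by simp), comap_top]

section Frattini

variable {G : Type*} [Group G] [Finite G] {f : G →* alternatingGroup (Fin 5)}

theorem le_frattini_or_eq_top (hf : Function.Surjective f) (hker : f.ker = frattini G)
    (N : Subgroup G) [N.Normal] : N ≤ frattini G ∨ N = ⊤ := by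
  have hN : (N.map f).Normal := Normal.map inferInstance f hf
  rcases hN.eq_bot_or_eq_top with h | h
  · left
    rw [← hker]
    exact (Subgroup.map_eq_bot_iff N).mp h
  · right
    apply frattini_nongenerating
    rw [← hker, ← comap_map_eq, h, comap_top]

theorem commutator_eq_top_of_ker_eq_frattini (hf : Function.Surjective f)
    (hker : f.ker = frattini G) : commutator G = ⊤ := by
  refine (le_frattini_or_eq_top hf hker (commutator G)).resolve_left fun h => ?_
  rw [← hker, ← Subgroup.map_eq_bot_iff, map_commutator_of_surjective hf,
    commutator_alternatingGroup_eq_top (by simp)] at h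
  exact top_ne_bot h

theorem isNilpotent_of_lt (hf : Function.Surjective f) (hker : f.ker = frattini G)
    (hpara : ParaNilHamiltonian G) {K H : Subgroup G} (hKH : K < H) (hH : H ≠ ⊤) :
    Group.IsNilpotent K := by
  have hsub : Group.IsNilpotent H → Group.IsNilpotent K := fun _ =>
    Group.nilpotent_of_mulEquiv (subgroupOfEquivOfLe hKH.le)
  by_cases hn : H.Normal
  · have hle := (le_frattini_or_eq_top hf hker H).resolve_right hH
    have := frattini_nilpotent (G := G)
    exact hsub (Group.nilpotent_of_mulEquiv (subgroupOfEquivOfLe hle))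
  · rcases hpara.2 H hn with h | h
    · exact hsub h
    · have := h.2 (K.subgroupOf H) fun htop => hKH.not_ge (subgroupOf_eq_top.mp htop)
      exact Group.nilpotent_of_mulEquiv (subgroupOfEquivOfLe hKH.le)

/-- The subgroup generated by the Frattini subgroup and a preimage of `x` is nilpotent. -/
theorem isNilpotent_comap_zpowers (hf : Function.Surjective f) (hker : f.ker = frattini G)
    (hpara : ParaNilHamiltonian G) {x y : alternatingGroup (Fin 5)} (hx : x.1 4 = 4)
    (hy : y.1 4 = 4) (hxy : ¬ Commute x y) : Group.IsNilpotent ((zpowers x).comap f) := by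
  let S : Subgroup (alternatingGroup (Fin 5)) :=
    (MulAction.stabilizer (Equiv.Perm (Fin 5)) (4 : Fin 5)).subgroupOf (alternatingGroup (Fin 5))
  have hS : S ≠ ⊤ := fun h => by
    have : fiveCycle ∈ S := h ▸ mem_top _
    have : (fiveCycle : Equiv.Perm (Fin 5)) 4 = 4 := this
    revert this
    decide
  have hlt : zpowers x < S := by
    refine lt_of_le_of_ne (zpowers_le.mpr hx) fun h => hxy ?_
    have hyS : y ∈ zpowers x := h ▸ (show y ∈ S from hy)
    obtain ⟨n, rfl⟩ := hyS
    exact (Commute.refl x).zpow_right n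
  refine isNilpotent_of_lt hf hker hpara ((comap_lt_comap_of_surjective hf).mpr hlt) fun h => hS ?_
  rw [← map_comap_eq_self_of_surjective hf S, h, map_top_of_surjective f hf]

/-- If `p` is the order of `x`, the elements of the Frattini subgroup of order prime to `p` are
central. -/
theorem mem_center_of_pow_eq_one (hf : Function.Surjective f) (hker : f.ker = frattini G)
    (hpara : ParaNilHamiltonian G) {x y : alternatingGroup (Fin 5)} (hx : x.1 4 = 4)
    (hy : y.1 4 = 4) (hxy : ¬ Commute x y) {p : ℕ} (hp : p.Prime) (hxp : orderOf x = p) {z : G}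
    (hz : z ∈ frattini G) {m : ℕ} (hzm : z ^ m = 1) (hpm : p.Coprime m) : z ∈ center G := by
  have := isNilpotent_comap_zpowers hf hker hpara hx hy hxy
  obtain ⟨g₀, hg₀⟩ := hf x
  obtain ⟨k, r, hr, hord⟩ := Nat.exists_eq_pow_mul_and_not_dvd (orderOf_pos g₀).ne' p hp.ne_one
  have hgpow : (g₀ ^ r) ^ p ^ k = 1 := by
    rw [← pow_mul, mul_comm, ← hord, pow_orderOf_eq_one]
  have hg : g₀ ^ r ∉ frattini G := by
    rw [← hker, MonoidHom.mem_ker, map_pow, hg₀, ← orderOf_dvd_iff_pow_eq_one, hxp]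
    exact hr
  have hgK : g₀ ^ r ∈ (zpowers x).comap f := by
    rw [mem_comap, map_pow, hg₀]
    exact pow_mem (mem_zpowers x) r
  have hcomm : ∀ w ∈ frattini G, w ^ m = 1 → Commute (g₀ ^ r) w := by
    intro w hw hwm
    have hwK : w ∈ (zpowers x).comap f := ker_le_comap f _ (hker ▸ hw)
    have h := Group.IsNilpotent.commute_of_coprime (x := (⟨_, hgK⟩ : (zpowers x).comap f))
      (y := ⟨w, hwK⟩) (Subtype.ext hgpow) (Subtype.ext hwm) (Nat.Coprime.pow_left k hpm)
    exact congrArg Subtype.val h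
  have hle : normalClosure {g₀ ^ r} ≤ centralizer {z} := by
    rw [normalClosure, closure_le]
    intro u hu
    obtain ⟨v, hv, huv⟩ := Group.mem_conjugatesOfSet_iff.mp hu
    rw [Set.mem_singleton_iff] at hv
    subst hv
    obtain ⟨c, rfl⟩ := isConj_iff.mp huv
    have h := hcomm (c⁻¹ * z * c⁻¹⁻¹) (Normal.conj_mem inferInstance z hz c⁻¹)
      (by rw [conj_pow, hzm]; simp)
    have h' := (Commute.conj_iff c).mpr h
    rw [SetLike.mem_coe, mem_centralizer_singleton_iff]
    simpa [mul_assoc] using h'.eq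
  have htop := (le_frattini_or_eq_top hf hker (normalClosure {g₀ ^ r})).resolve_left fun h =>
    hg (h (subset_normalClosure rfl))
  rw [htop] at hle
  exact mem_center_iff.mpr fun u => mem_centralizer_singleton_iff.mp (hle (mem_top u))

theorem frattini_le_center (hf : Function.Surjective f) (hker : f.ker = frattini G)
    (hpara : ParaNilHamiltonian G) : frattini G ≤ center G := by
  intro z hz
  obtain ⟨k, m, hm, hord⟩ := Nat.exists_eq_pow_mul_and_not_dvd (orderOf_pos z).ne' 2 (by norm_num)
  have hodd : Nat.Coprime 2 m := (Nat.Prime.coprime_iff_not_dvd Nat.prime_two).mpr hm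
  have hne : ¬ Commute doubleSwap threeCycle := by
    rw [commute_iff_eq]
    decide
  have h₁ : z ^ 2 ^ k ∈ center G :=
    mem_center_of_pow_eq_one hf hker hpara (x := doubleSwap) (y := threeCycle) (by decide)
      (by decide) hne Nat.prime_two (orderOf_eq_prime (by decide) (by decide))
      (pow_mem hz _) (by rw [← pow_mul, ← hord, pow_orderOf_eq_one]) hodd
  have h₂ : z ^ m ∈ center G :=
    mem_center_of_pow_eq_one hf hker hpara (x := threeCycle) (y := doubleSwap) (by decide)
      (by decide) (fun h => hne h.symm) Nat.prime_three orderOf_threeCycle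
      (pow_mem hz _) (by rw [← pow_mul, mul_comm, ← hord, pow_orderOf_eq_one])
      (Nat.Coprime.pow_right k (by norm_num))
  have hcop : (2 ^ k).Coprime m := Nat.Coprime.pow_left k hodd
  have hgcd : z ^ ((2 ^ k).gcd m : ℤ) ∈ center G := by
    rw [Nat.gcd_eq_gcd_ab, zpow_add, zpow_mul, zpow_mul, zpow_natCast, zpow_natCast]
    exact mul_mem (zpow_mem h₁ _) (zpow_mem h₂ _)
  rwa [hcop.gcd_eq_one, Nat.cast_one, zpow_one] at hgcd

end Frattini

/-- If $G$ is a finite para-Nil-Hamiltonian group with $G/\Phi(G) \cong A_5$, then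
$G \cong A_5$ or $G \cong \mathrm{SL}(2,5)$. -/
theorem stmt_1 {G : Type*} [Group G] [Finite G]
    (hiso : Nonempty ((G ⧸ frattini G) ≃* ↥(alternatingGroup (Fin 5))))
    (hpara : ParaNilHamiltonian G) :
    Nonempty (G ≃* ↥(alternatingGroup (Fin 5))) ∨
      Nonempty (G ≃* Matrix.SpecialLinearGroup (Fin 2) (ZMod 5)) := by
  obtain ⟨e⟩ := hiso
  let f : G →* alternatingGroup (Fin 5) := e.toMonoidHom.comp (QuotientGroup.mk' (frattini G))
  have hf : Function.Surjective f := e.surjective.comp (QuotientGroup.mk'_surjective _)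
  have hker : f.ker = frattini G := by
    ext g
    simp [f]
  have hcenter : f.ker ≤ center G := hker.trans_le (frattini_le_center hf hker hpara)
  have hperf := commutator_eq_top_of_ker_eq_frattini hf hker
  have hle := card_ker_le_two hf hcenter hperf
  have hpos : 0 < Nat.card f.ker := Nat.card_pos
  obtain h | h : Nat.card f.ker = 1 ∨ Nat.card f.ker = 2 := by omega
  · exact .inl ⟨MulEquiv.ofBijective f ⟨(MonoidHom.ker_eq_bot_iff f).mp (card_eq_one.mp h), hf⟩⟩
  · obtain ⟨f', hf', hker', hperf'⟩ := exists_specialLinearGroup_hom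
    have hcard : Nat.card G = 120 := by
      rw [← f.ker.card_mul_index, h, index_ker, MonoidHom.range_eq_top.mpr hf, card_top,
        nat_card_alternatingGroup_five]
    exact .inr (exists_mulEquiv_of_perfect_central_extensions hf hf' hcenter hker' hperf hperf'
      hcard card_specialLinearGroup_two_five)
end
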